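/- Let κ > 0 and ṽ_1^κ(r) = i · D_1( exp(e^{-i 3π/4} κ r) - exp(e^{i 3π/4} κ r) ), where (D_1 w)(r) = w'(r) - w(r)/r. Then ∫_0^∞ (ṽ_1^κ(r))^2 dr = κ/√2. -/

import Mathlib

open Set MeasureTheory

/-- The differential operation `(D_1 w)(r) = w'(r) - w(r)/r`. -/
noncomputable def D1 (w : ℝ → ℂ) : ℝ → ℂ :=
  fun r => deriv w r - w r / (r : ℂ)

/-- The eigenfunction `ṽ_1^κ = i D_1(exp(e^{-i3π/4} κ r) - exp(e^{i3π/4} κ r))`. -/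
noncomputable def vTilde1 (κ : ℝ) : ℝ → ℂ :=
  fun r => Complex.I * D1 (fun s =>
    Complex.exp (Complex.exp (-Complex.I * (3 * Real.pi / 4)) * κ * s)
      - Complex.exp (Complex.exp (Complex.I * (3 * Real.pi / 4)) * κ * s)) r

/-- The exponentials at the conjugate points `e^{∓i3π/4} κ s` differ by a damped sine. -/
lemma exp_sub_exp_eq_damped_sin (κ s : ℝ) :
    Complex.exp (Complex.exp (-Complex.I * (3 * Real.pi / 4)) * κ * s)
      - Complex.exp (Complex.exp (Complex.I * (3 * Real.pi / 4)) * κ * s)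
    = -2 * Complex.I *
      ((Real.exp (-(κ / √2 * s)) * Real.sin (κ / √2 * s) : ℝ) : ℂ) := by
  have hc : Real.cos (3 * Real.pi / 4) = -(1 / √2) := by
    rw [show 3 * Real.pi / 4 = Real.pi - Real.pi / 4 by ring, Real.cos_pi_sub,
      Real.cos_pi_div_four, Real.sqrt_div_self']
  have hs : Real.sin (3 * Real.pi / 4) = 1 / √2 := by
    rw [show 3 * Real.pi / 4 = Real.pi - Real.pi / 4 by ring, Real.sin_pi_sub,
      Real.sin_pi_div_four, Real.sqrt_div_self']
  have h1 : Complex.exp (Complex.I * (3 * Real.pi / 4)) * κ * s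
      = ((-(κ / √2 * s) : ℝ) : ℂ) + ((κ / √2 * s : ℝ) : ℂ) * Complex.I := by
    rw [show Complex.I * (3 * Real.pi / 4) = ((3 * Real.pi / 4 : ℝ) : ℂ) * Complex.I by
      push_cast; ring, Complex.exp_mul_I, ← Complex.ofReal_cos, ← Complex.ofReal_sin, hc, hs]
    push_cast
    ring
  have h2 : Complex.exp (-Complex.I * (3 * Real.pi / 4)) * κ * s
      = ((-(κ / √2 * s) : ℝ) : ℂ) + ((-(κ / √2 * s) : ℝ) : ℂ) * Complex.I := by
    rw [show -Complex.I * (3 * Real.pi / 4) = ((-(3 * Real.pi / 4) : ℝ) : ℂ) * Complex.I by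
      push_cast; ring, Complex.exp_mul_I, ← Complex.ofReal_cos, ← Complex.ofReal_sin,
      Real.cos_neg, Real.sin_neg, hc, hs]
    push_cast
    ring
  rw [h1, h2, Complex.exp_add, Complex.exp_add, Complex.exp_mul_I, Complex.exp_mul_I,
    ← Complex.ofReal_cos, ← Complex.ofReal_sin, ← Complex.ofReal_cos, ← Complex.ofReal_sin,
    Real.cos_neg, Real.sin_neg]
  push_cast
  ring

lemma hasDerivAt_exp_neg_mul (c r : ℝ) :
    HasDerivAt (fun s => Real.exp (-(c * s))) (-c * Real.exp (-(c * r))) r := by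
  have h := ((hasDerivAt_id r).const_mul (-c)).exp
  simp only [id, neg_mul] at h
  convert h using 1
  ring

lemma hasDerivAt_sin_mul (c r : ℝ) :
    HasDerivAt (fun s => Real.sin (c * s)) (c * Real.cos (c * r)) r := by
  have h := ((hasDerivAt_id r).const_mul c).sin
  simp only [id] at h
  convert h using 1
  ring

lemma hasDerivAt_cos_mul (c r : ℝ) :
    HasDerivAt (fun s => Real.cos (c * s)) (-c * Real.sin (c * r)) r := by
  have h := ((hasDerivAt_id r).const_mul c).cos
  simp only [id] at h
  convert h using 1
  ring

/-- The real form of the eigenfunction. -/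
lemma vTilde1_eq_ofReal (κ r : ℝ) :
    vTilde1 κ r = ((2 * (-(κ / √2) * Real.exp (-(κ / √2 * r)) * Real.sin (κ / √2 * r)
      + Real.exp (-(κ / √2 * r)) * (κ / √2 * Real.cos (κ / √2 * r))
      - Real.exp (-(κ / √2 * r)) * Real.sin (κ / √2 * r) / r) : ℝ) : ℂ) := by
  have hd := (((hasDerivAt_exp_neg_mul (κ / √2) r).mul
    (hasDerivAt_sin_mul (κ / √2) r)).ofReal_comp.const_mul (-2 * Complex.I)).deriv
  simp only [Pi.mul_apply] at hd
  unfold vTilde1 D1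
  simp only [exp_sub_exp_eq_damped_sin]
  rw [hd]
  push_cast
  linear_combination (-2 * (-(κ / √2) * Complex.exp (-(κ / √2 * r)) * Complex.sin (κ / √2 * r)
      + Complex.exp (-(κ / √2 * r)) * (κ / √2 * Complex.cos (κ / √2 * r))
      - Complex.exp (-(κ / √2 * r)) * Complex.sin (κ / √2 * r) / r)) * Complex.I_sq

lemma integral_Ioi_sq_damped_sin {c : ℝ} (hc : 0 < c) :
    ∫ r in Ioi (0 : ℝ), (2 * (-c * Real.exp (-(c * r)) * Real.sin (c * r)
      + Real.exp (-(c * r)) * (c * Real.cos (c * r))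
      - Real.exp (-(c * r)) * Real.sin (c * r) / r)) ^ 2 = c := by
  let H : ℝ → ℝ := fun r => Real.exp (-(c * r)) ^ 2 *
    (-c + 2 * c * (Real.sin (c * r) * Real.cos (c * r)) - 2 * c * Real.sin (c * r) ^ 2
      - 4 * (Real.sin (c * r) ^ 2 / r))
  have hcont : Continuous H := by
    have hH : H = fun r => Real.exp (-(c * r)) ^ 2 *
        (-c + 2 * c * (Real.sin (c * r) * Real.cos (c * r)) - 2 * c * Real.sin (c * r) ^ 2
          - 4 * (c ^ 2 * r * Real.sinc (c * r) ^ 2)) := by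
      funext r
      rcases eq_or_ne r 0 with rfl | hr
      · simp [H]
      · simp only [H, Real.sinc_of_ne_zero (mul_ne_zero hc.ne' hr)]
        field_simp
    rw [hH]
    have hsinc := Real.continuous_sinc
    fun_prop
  have hderiv : ∀ r ∈ Ioi (0 : ℝ), HasDerivAt H ((2 * (-c * Real.exp (-(c * r)) * Real.sin (c * r)
      + Real.exp (-(c * r)) * (c * Real.cos (c * r))
      - Real.exp (-(c * r)) * Real.sin (c * r) / r)) ^ 2) r := by
    intro r hr
    have hr0 : r ≠ 0 := ne_of_gt hr
    have hE := hasDerivAt_exp_neg_mul c r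
    have hS := hasDerivAt_sin_mul c r
    have hC := hasDerivAt_cos_mul c r
    have h := (hE.pow 2).mul (((((hS.mul hC).const_mul (2 * c)).const_add (-c)).sub
      ((hS.pow 2).const_mul (2 * c))).sub (((hS.pow 2).div (hasDerivAt_id r) hr0).const_mul 4))
    refine h.congr_deriv ?_
    simp only [Pi.mul_apply, Pi.pow_apply, Pi.sub_apply, Pi.div_apply, id]
    have hsc := Real.sin_sq_add_cos_sq (c * r)
    generalize Real.sin (c * r) = s at *
    generalize Real.cos (c * r) = k at *
    generalize Real.exp (-(c * r)) = e at *
    field_simp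
    push_cast
    linear_combination (-2 * e ^ 2 * c ^ 2 * r ^ 2) * hsc
  have hlim : Filter.Tendsto H Filter.atTop (nhds 0) := by
    have hE : Filter.Tendsto (fun r => Real.exp (-(c * r)) ^ 2) Filter.atTop (nhds 0) := by
      have h := (Real.tendsto_exp_neg_atTop_nhds_zero.comp
        (Filter.tendsto_id.const_mul_atTop hc)).pow 2
      simpa using h
    have hB := hE.mul_const (5 * c + 4)
    rw [zero_mul] at hB
    refine squeeze_zero_norm' ?_ hB
    filter_upwards [Filter.eventually_ge_atTop (1 : ℝ)] with r hr
    simp only [H, Real.norm_eq_abs, abs_mul, abs_of_nonneg (sq_nonneg (Real.exp (-(c * r))))]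
    refine mul_le_mul_of_nonneg_left ?_ (sq_nonneg _)
    have hsc := Real.sin_sq_add_cos_sq (c * r)
    have hq0 : 0 ≤ Real.sin (c * r) ^ 2 / r := by positivity
    have hq1 : Real.sin (c * r) ^ 2 / r ≤ 1 :=
      div_le_one_of_le₀ ((Real.sin_sq_le_one _).trans hr) (by linarith)
    have hs1 := Real.sin_sq_le_one (c * r)
    have hm1 : Real.sin (c * r) * Real.cos (c * r) ≤ 1 := by
      nlinarith [sq_nonneg (Real.sin (c * r) - Real.cos (c * r))]
    have hm2 : -1 ≤ Real.sin (c * r) * Real.cos (c * r) := by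
      nlinarith [sq_nonneg (Real.sin (c * r) + Real.cos (c * r))]
    have h1 := mul_le_mul_of_nonneg_left hm1 hc.le
    have h2 := mul_le_mul_of_nonneg_left hm2 hc.le
    have h3 := mul_le_mul_of_nonneg_left hs1 hc.le
    have h4 := mul_nonneg hc.le (sq_nonneg (Real.sin (c * r)))
    rw [abs_le]
    constructor <;> linarith
  rw [integral_Ioi_of_hasDerivAt_of_nonneg hcont.continuousWithinAt hderiv
    (fun _ _ => sq_nonneg _) hlim]
  simp [H]

/-- Normalization of the `l = 1` eigenfunction: `∫_0^∞ (ṽ_1^κ)² dr = κ/√2`. -/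
theorem stmt12 (κ : ℝ) (hκ : 0 < κ) :
    ∫ r in Ioi (0 : ℝ), (vTilde1 κ r) ^ 2 = ((κ / Real.sqrt 2 : ℝ) : ℂ) := by
  simp only [vTilde1_eq_ofReal, ← Complex.ofReal_pow]
  rw [integral_complex_ofReal,
    integral_Ioi_sq_damped_sin (div_pos hκ (Real.sqrt_pos.2 two_pos))]
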